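/- (The Kraft–Pratt–Seidenberg scale is indivisible) There is no divided basic scaling ρ : A → P on any Boolean algebra A containing pairwise disjoint elements a, b, c, d, e with a ∨ b ∨ c ∨ d ∨ e = 1 such that ρ(a ∨ d) < ρ(b ∨ c), ρ(b ∨ e) < ρ(c ∨ d), ρ(c) < ρ(b ∨ d), and ρ(b ∨ c ∨ d) < ρ(a ∨ e) all hold. -/

import Mathlib

/-- A *basic scaling* is a strictly increasing map from a Boolean algebra to a
partially ordered set that preserves relative complementation. -/
structure IsBasicScaling {A P : Type*} [BooleanAlgebra A] [PartialOrder P]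
    (ρ : A → P) : Prop where
  mono : ∀ x y : A, x < y → ρ x < ρ y
  relcomp_lt : ∀ a b x y : A, a ≤ x → x ≤ b → a ≤ y → y ≤ b →
      ρ x < ρ y → ρ (a ⊔ (b ⊓ yᶜ)) < ρ (a ⊔ (b ⊓ xᶜ))
  relcomp_eq : ∀ a b x y : A, a ≤ x → x ≤ b → a ≤ y → y ≤ b →
      ρ x = ρ y → ρ (a ⊔ (b ⊓ xᶜ)) = ρ (a ⊔ (b ⊓ yᶜ))

/-- A basic scaling is *divided* if whenever `ρ x < ρ y` there is `y₁ < y`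
with `ρ y₁ = ρ x`. -/
def Divided {A P : Type*} [BooleanAlgebra A] [PartialOrder P] (ρ : A → P) : Prop :=
  ∀ x y : A, ρ x < ρ y → ∃ y₁, y₁ < y ∧ ρ y₁ = ρ x

theorem sup_sdiff_sup_inf {A : Type*} [BooleanAlgebra A] (x x' y : A) :
    x ⊔ y \ x' ⊔ x' ⊓ y = x ⊔ y := by
  rw [sup_assoc, inf_comm, sup_comm (y \ x'), sup_inf_sdiff]

theorem compl_sup_compl_sup {A : Type*} [BooleanAlgebra A] {x y : A}
    (hxy : Disjoint x y) : (x ⊔ (x ⊔ y)ᶜ)ᶜ = y := by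
  rw [compl_sup, compl_compl, inf_sup_left, compl_inf_self, bot_sup_eq]
  exact inf_eq_right.2 hxy.le_compl_left

namespace IsBasicScaling

variable {A P : Type*} [BooleanAlgebra A] [PartialOrder P] {ρ : A → P}

theorem compl_lt (h : IsBasicScaling ρ) {x y : A} (hxy : ρ x < ρ y) : ρ yᶜ < ρ xᶜ := by
  simpa using h.relcomp_lt ⊥ ⊤ x y bot_le le_top bot_le le_top hxy

theorem compl_eq (h : IsBasicScaling ρ) {x y : A} (hxy : ρ x = ρ y) : ρ xᶜ = ρ yᶜ := by
  simpa using h.relcomp_eq ⊥ ⊤ x y bot_le le_top bot_le le_top hxy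

theorem compl_le (h : IsBasicScaling ρ) {x y : A} (hxy : ρ x ≤ ρ y) : ρ yᶜ ≤ ρ xᶜ :=
  hxy.lt_or_eq.elim (fun hlt => (h.compl_lt hlt).le) fun heq => (h.compl_eq heq).ge

theorem sup_right_lt (h : IsBasicScaling ρ) {x y z : A} (hxz : Disjoint x z)
    (hyz : Disjoint y z) (hxy : ρ x < ρ y) : ρ (x ⊔ z) < ρ (y ⊔ z) := by
  have := h.compl_lt (h.relcomp_lt ⊥ zᶜ x y bot_le hxz.le_compl_right bot_le
    hyz.le_compl_right hxy)
  simpa [compl_inf, sup_comm] using this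

theorem sup_right_eq (h : IsBasicScaling ρ) {x y z : A} (hxz : Disjoint x z)
    (hyz : Disjoint y z) (hxy : ρ x = ρ y) : ρ (x ⊔ z) = ρ (y ⊔ z) := by
  have := h.compl_eq (h.relcomp_eq ⊥ zᶜ x y bot_le hxz.le_compl_right bot_le
    hyz.le_compl_right hxy)
  simpa [compl_inf, sup_comm] using this

theorem sup_right_le (h : IsBasicScaling ρ) {x y z : A} (hxz : Disjoint x z)
    (hyz : Disjoint y z) (hxy : ρ x ≤ ρ y) : ρ (x ⊔ z) ≤ ρ (y ⊔ z) :=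
  hxy.lt_or_eq.elim (fun hlt => (h.sup_right_lt hxz hyz hlt).le)
    fun heq => (h.sup_right_eq hxz hyz heq).le

/-- The exchange step behind additivity: a comparison `ρ x ≤ ρ x'` extends to the part of `y`
outside `x'`, and the right-hand side is again a disjoint join with `y`. -/
theorem sup_sdiff_le_sup_sdiff (h : IsBasicScaling ρ) {x x' y : A} (hxy : Disjoint x y)
    (hx : ρ x ≤ ρ x') :
    ρ (x ⊔ y \ x') ≤ ρ (y ⊔ x' \ y) := by
  have := h.sup_right_le (hxy.mono_right sdiff_le) disjoint_sdiff_self_right hx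
  rwa [sup_sdiff_self_right, sup_comm x', ← sup_sdiff_self_right y x'] at this

theorem sup_lt_sup (h : IsBasicScaling ρ) {x x' y y' : A} (hxy : Disjoint x y)
    (hxy' : Disjoint x' y') (hx : ρ x ≤ ρ x') (hy : ρ y < ρ y') :
    ρ (x ⊔ y) < ρ (x' ⊔ y') := by
  have hlt := (h.sup_sdiff_le_sup_sdiff hxy hx).trans_lt
    (h.sup_right_lt disjoint_sdiff_self_right (hxy'.symm.mono_right sdiff_le) hy)
  have := h.sup_right_lt (z := x' ⊓ y)
    (disjoint_sup_left.2 ⟨hxy.mono_right inf_le_right,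
      disjoint_sdiff_self_left.mono_right inf_le_left⟩)
    (disjoint_sup_left.2 ⟨hxy'.symm.mono_right inf_le_left,
      disjoint_sdiff_self_left.mono_right inf_le_right⟩) hlt
  rwa [sup_sdiff_sup_inf, inf_comm, sup_sdiff_sup_inf, sup_comm y'] at this

theorem sup_le_sup (h : IsBasicScaling ρ) {x x' y y' : A} (hxy : Disjoint x y)
    (hxy' : Disjoint x' y') (hx : ρ x ≤ ρ x') (hy : ρ y ≤ ρ y') :
    ρ (x ⊔ y) ≤ ρ (x' ⊔ y') := by
  have hle := (h.sup_sdiff_le_sup_sdiff hxy hx).trans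
    (h.sup_right_le disjoint_sdiff_self_right (hxy'.symm.mono_right sdiff_le) hy)
  have := h.sup_right_le (z := x' ⊓ y)
    (disjoint_sup_left.2 ⟨hxy.mono_right inf_le_right,
      disjoint_sdiff_self_left.mono_right inf_le_left⟩)
    (disjoint_sup_left.2 ⟨hxy'.symm.mono_right inf_le_left,
      disjoint_sdiff_self_left.mono_right inf_le_right⟩) hle
  rwa [sup_sdiff_sup_inf, inf_comm, sup_sdiff_sup_inf, sup_comm y'] at this

theorem lt_of_sup_lt_sup (h : IsBasicScaling ρ) {x x' y y' : A} (hxy : Disjoint x y)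
    (hxy' : Disjoint x' y') (hx : ρ x' ≤ ρ x) (hlt : ρ (x ⊔ y) < ρ (x' ⊔ y')) :
    ρ y < ρ y' := by
  have := h.compl_lt (h.sup_lt_sup (disjoint_compl_right.mono_left le_sup_left)
    (disjoint_compl_right.mono_left le_sup_left) hx (h.compl_lt hlt))
  rwa [compl_sup_compl_sup hxy, compl_sup_compl_sup hxy'] at this

theorem le_of_sup_le_sup (h : IsBasicScaling ρ) {x x' y y' : A} (hxy : Disjoint x y)
    (hxy' : Disjoint x' y') (hx : ρ x' ≤ ρ x) (hle : ρ (x ⊔ y) ≤ ρ (x' ⊔ y')) :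
    ρ y ≤ ρ y' := by
  have := h.compl_le (h.sup_le_sup (disjoint_compl_right.mono_left le_sup_left)
    (disjoint_compl_right.mono_left le_sup_left) hx (h.compl_le hle))
  rwa [compl_sup_compl_sup hxy, compl_sup_compl_sup hxy'] at this

theorem monotone (h : IsBasicScaling ρ) : Monotone ρ :=
  (show StrictMono ρ from fun x y => h.mono x y).monotone

/-- In a divided scaling, a splitting of an element transfers to every equivalent element. -/
theorem exists_split (h : IsBasicScaling ρ) (hdiv : Divided ρ) {x y z : A}
    (hxy : Disjoint x y) (hz : ρ (x ⊔ y) = ρ z) :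
    ∃ x' y', Disjoint x' y' ∧ x' ⊔ y' = z ∧ ρ x' = ρ x ∧ ρ y' = ρ y := by
  obtain ⟨x', hx'z, hx'⟩ : ∃ x' ≤ z, ρ x' = ρ x := by
    rcases (h.monotone (le_sup_left : x ≤ x ⊔ y)).lt_or_eq with hlt | heq
    · obtain ⟨x', hlt', hx'⟩ := hdiv x z (hz ▸ hlt)
      exact ⟨x', hlt'.le, hx'⟩
    · exact ⟨z, le_rfl, (heq.trans hz).symm⟩
  have hsup : x' ⊔ z \ x' = z := sup_sdiff_cancel_right hx'z
  refine ⟨x', z \ x', disjoint_sdiff_self_right, hsup, hx', le_antisymm ?_ ?_⟩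
  · exact h.le_of_sup_le_sup disjoint_sdiff_self_right hxy hx'.ge (by rw [hsup, hz])
  · exact h.le_of_sup_le_sup hxy disjoint_sdiff_self_right hx'.le (by rw [hsup, hz])

end IsBasicScaling

theorem stmt_16 {A P : Type*} [BooleanAlgebra A] [PartialOrder P] (ρ : A → P)
    (h : IsBasicScaling ρ) (hdiv : Divided ρ) (a b c d e : A)
    (hab : a ⊓ b = ⊥) (hac : a ⊓ c = ⊥) (had : a ⊓ d = ⊥) (hae : a ⊓ e = ⊥)
    (hbc : b ⊓ c = ⊥) (hbd : b ⊓ d = ⊥) (hbe : b ⊓ e = ⊥)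
    (hcd : c ⊓ d = ⊥) (hce : c ⊓ e = ⊥) (hde : d ⊓ e = ⊥)
    (hsup : a ⊔ b ⊔ c ⊔ d ⊔ e = ⊤) :
    ¬ (ρ (a ⊔ d) < ρ (b ⊔ c) ∧ ρ (b ⊔ e) < ρ (c ⊔ d) ∧
       ρ c < ρ (b ⊔ d) ∧ ρ (b ⊔ c ⊔ d) < ρ (a ⊔ e)) := by
  rintro ⟨had_bc, hbe_cd, hc_bd, hbcd_ae⟩
  obtain ⟨c', hc'lt, hc'⟩ := hdiv _ _ hc_bd
  obtain ⟨b₁, b₂, hb, rfl, hb₁⟩ : ∃ b₁ b₂, Disjoint b₁ b₂ ∧ b₁ ⊔ b₂ = b ∧ b₁ = c' ⊓ b :=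
    ⟨c' ⊓ b, b \ c', disjoint_sdiff_self_right.mono_left inf_le_left,
      by rw [inf_comm, sup_inf_sdiff], rfl⟩
  obtain ⟨d₁, d₂, hd, rfl, hd₁⟩ : ∃ d₁ d₂, Disjoint d₁ d₂ ∧ d₁ ⊔ d₂ = d ∧ d₁ = c' ⊓ d :=
    ⟨c' ⊓ d, d \ c', disjoint_sdiff_self_right.mono_left inf_le_left,
      by rw [inf_comm, sup_inf_sdiff], rfl⟩
  have hsplit : b₁ ⊔ d₁ = c' := by
    rw [hb₁, hd₁, ← inf_sup_left, inf_eq_left.2 hc'lt.le]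
  clear hb₁ hd₁ hsup
  simp only [← disjoint_iff, disjoint_sup_left, disjoint_sup_right] at *
  obtain ⟨c₁, c₂, hc, rfl, hc₁, hc₂⟩ :=
    h.exists_split hdiv (x := b₁) (y := d₁) (z := c) (by tauto) (hsplit ▸ hc')
  simp only [disjoint_sup_left, disjoint_sup_right] at *
  have hsymm : ∀ {x y : A}, Disjoint x y → Disjoint y x := fun h => h.symm
  have had₂ : ρ (a ⊔ d₂) < ρ (b₁ ⊔ b₂ ⊔ c₁) := by
    refine h.lt_of_sup_lt_sup (x := d₁) (x' := c₂) ?_ ?_ hc₂.le ?_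
    · simp only [disjoint_sup_right]; grind
    · simp only [disjoint_sup_right]; grind
    · convert had_bc using 2 <;> ac_rfl
  have hb₂e : ρ (b₂ ⊔ e) < ρ (c₂ ⊔ (d₁ ⊔ d₂)) := by
    refine h.lt_of_sup_lt_sup (x := b₁) (x' := c₁) ?_ ?_ hc₁.le ?_
    · simp only [disjoint_sup_right]; grind
    · simp only [disjoint_sup_right]; grind
    · convert hbe_cd using 2 <;> ac_rfl
  have hlt : ρ (a ⊔ d₂ ⊔ (b₂ ⊔ e)) < ρ (b₁ ⊔ b₂ ⊔ c₁ ⊔ (c₂ ⊔ (d₁ ⊔ d₂))) := by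
    refine h.sup_lt_sup ?_ ?_ had₂.le hb₂e <;>
      simp only [disjoint_sup_left, disjoint_sup_right] <;> grind
  have hle : ρ (a ⊔ e) ≤ ρ (a ⊔ d₂ ⊔ (b₂ ⊔ e)) :=
    h.monotone (_root_.sup_le_sup le_sup_left le_sup_right)
  refine lt_irrefl _ ((hle.trans_lt hlt).trans ?_)
  convert hbcd_ae using 2
  ac_rfl
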